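/- Let R be a ring, e an idempotent in R, f = 1 − e, and a ∈ eRe. If a is unit regular in the corner ring eRe, then for every unit b of the corner ring fRf, the element a + b is unit regular in R. -/

import Mathlib

/-- Elements of the corners of two idempotents `e`, `f` with `e * f = 0` multiply to zero. -/
lemma corner_mul_corner_eq_zero {R : Type*} [Ring R] {e f x y : R} (hef : e * f = 0)
    (hx : x = e * x * e) (hy : y = f * y * f) : x * y = 0 := by
  rw [hx, hy]
  calc e * x * e * (f * y * f) = e * x * (e * f) * (y * f) := by simp only [mul_assoc]
    _ = 0 := by rw [hef, mul_zero, zero_mul]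

/-- If `a ∈ eRe` is unit regular in `eRe`, then for every unit `b` of the corner ring `fRf`
(where `f = 1 - e`), the element `a + b` is unit regular in `R`. -/
theorem unitRegular_add_unit_of_corner_unitRegular {R : Type*} [Ring R] (e f a : R)
    (he : e * e = e) (hf : f = 1 - e) (ha : a = e * a * e)
    (h : ∃ w : R, w = e * w * e ∧
        (∃ y : R, y = e * y * e ∧ w * y = e ∧ y * w = e) ∧ a = a * w * a) :
    ∀ b : R, b = f * b * f → (∃ y : R, y = f * y * f ∧ b * y = f ∧ y * b = f) →
      ∃ u : Rˣ, a + b = (a + b) * u * (a + b) := by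
  rintro b hb ⟨c, hc, hbc, hcb⟩
  obtain ⟨w, hw, ⟨y, hy, hwy, hyw⟩, haw⟩ := h
  have hef : e * f = 0 := by rw [hf, mul_sub, mul_one, he, sub_self]
  have hfe : f * e = 0 := by rw [hf, sub_mul, one_mul, he, sub_self]
  have hff : f * f = f := by
    nth_rw 1 [hf]
    rw [sub_mul, one_mul, hef, sub_zero]
  have hone : e + f = 1 := by rw [hf, add_sub_cancel]
  have hfb : f * b = b := by
    rw [hb]
    simp only [← mul_assoc, hff]
  refine ⟨⟨w + c, y + b, ?_, ?_⟩, ?_⟩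
  · rw [add_mul, mul_add, mul_add, hwy, hcb, corner_mul_corner_eq_zero hef hw hb,
      corner_mul_corner_eq_zero hfe hc hy, add_zero, zero_add, hone]
  · rw [add_mul, mul_add, mul_add, hyw, hbc, corner_mul_corner_eq_zero hef hy hc,
      corner_mul_corner_eq_zero hfe hb hw, add_zero, zero_add, hone]
  · have hu : (a + b) * (w + c) = a * w + f := by
      rw [add_mul, mul_add, mul_add, hbc, corner_mul_corner_eq_zero hef ha hc,
        corner_mul_corner_eq_zero hfe hb hw, add_zero, zero_add]
    have hfa : f * a = 0 := by rw [ha, ← mul_assoc, ← mul_assoc, hfe, zero_mul, zero_mul]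
    change a + b = (a + b) * (w + c) * (a + b)
    rw [hu, add_mul, mul_add, mul_add, ← haw, mul_assoc, corner_mul_corner_eq_zero hef hw hb,
      mul_zero, hfa, hfb, add_zero, zero_add]
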